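/- Let Γ = { u : ℕ → {0,1} : for all k ≥ 0, ū ≤ T^k(u) ≤ u in the lexicographic order }, where ū denotes the sequence obtained from u by exchanging 0's and 1's (ū(n) = 1 − u(n)). Then a Sturmian binary sequence s belongs to Γ if and only if there exists an irrational α ∈ (0,1) such that the characteristic Sturmian sequence c_α of slope α begins with the letter 1 and s = 1·c_α. -/

import Mathlib

/-- The finite word `s(i) s(i+1) ⋯ s(i+k−1)`. -/
def window {A : Type*} (s : ℕ → A) (i k : ℕ) : List A :=
  (List.range k).map fun j => s (i + j)

/-- `l` is a factor of the sequence `s`. -/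
def IsFactor {A : Type*} (s : ℕ → A) (l : List A) : Prop :=
  ∃ i, l = window s i l.length

/-- The number of distinct factors of `s` of length `k` (complexity function). -/
noncomputable def complexity {A : Type*} (s : ℕ → A) (k : ℕ) : ℕ :=
  Set.ncard {l : List A | l.length = k ∧ IsFactor s l}

/-- The shift map. -/
def shiftMap {A : Type*} (s : ℕ → A) : ℕ → A := fun n => s (n + 1)

/-- The sequence `x·u`. -/
def pre {A : Type*} (x : A) (u : ℕ → A) : ℕ → A
  | 0 => x
  | n + 1 => u n

/-- Strict lexicographic order on sequences. -/
def SeqLt {A : Type*} [LT A] (u v : ℕ → A) : Prop :=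
  ∃ i, (∀ j < i, u j = v j) ∧ u i < v i

/-- Lexicographic order on sequences. -/
def SeqLe {A : Type*} [LT A] (u v : ℕ → A) : Prop :=
  (∀ n, u n = v n) ∨ SeqLt u v

/-- Lexicographic order on (equal-length) finite words. -/
def WordLe {A : Type*} [LT A] (u v : List A) : Prop :=
  u = v ∨ List.Lex (· < ·) u v

def UltimatelyPeriodic {A : Type*} (s : ℕ → A) : Prop :=
  ∃ N, ∃ q ≥ 1, ∀ n ≥ N, s (n + q) = s n

/-- A binary sequence is Sturmian if it has complexity `k + 1` for all `k ≥ 1`. -/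
def Sturmian (s : ℕ → Fin 2) : Prop :=
  ∀ k ≥ 1, complexity s k = k + 1

/-- `w` is a left special factor of `s`. -/
def LeftSpecial {A : Type*} (s : ℕ → A) (w : List A) : Prop :=
  ∃ x y : A, x ≠ y ∧ IsFactor s (x :: w) ∧ IsFactor s (y :: w)

/-- A binary sequence is balanced. -/
def BalancedSeq (s : ℕ → Fin 2) : Prop :=
  ∀ u v : List (Fin 2), IsFactor s u → IsFactor s v → u.length = v.length →
    ((u.count 1 : ℤ) - (v.count 1 : ℤ)).natAbs ≤ 1

/-- `u` is the characteristic Sturmian sequence of slope `α`. -/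
def IsCharSturmian (α : ℝ) (u : ℕ → Fin 2) : Prop :=
  ∀ n : ℕ, ((u n : ℕ) : ℤ) = ⌊((n : ℝ) + 2) * α⌋ - ⌊((n : ℝ) + 1) * α⌋

/-- The sequence obtained from `u` by exchanging `0`'s and `1`'s. -/
def flipSeq (u : ℕ → Fin 2) : ℕ → Fin 2 := fun n => if u n = 0 then 1 else 0

namespace St

/-- Windows of length `k` at `i`, `j` agree. -/
def E (s : ℕ → Fin 2) (k i j : ℕ) : Prop := ∀ t < k, s (i + t) = s (j + t)

lemma window_eq (s : ℕ → Fin 2) (k i j : ℕ) : window s i k = window s j k ↔ E s k i j := by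
  unfold window E
  rw [List.map_inj_left]
  simp

lemma E.symm {s : ℕ → Fin 2} {k i j : ℕ} (h : E s k i j) : E s k j i := fun t ht => (h t ht).symm
lemma E.trans {s : ℕ → Fin 2} {k i j l : ℕ} (h : E s k i j) (h' : E s k j l) : E s k i l :=
  fun t ht => (h t ht).trans (h' t ht)
lemma E.mono {s : ℕ → Fin 2} {k k' i j : ℕ} (h : E s k i j) (hk : k' ≤ k) : E s k' i j :=
  fun t ht => h t (by omega)
lemma E.succ {s : ℕ → Fin 2} {k i j : ℕ} (h : E s k i j) (h' : s (i + k) = s (j + k)) :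
    E s (k+1) i j := by
  intro t ht
  rcases Nat.lt_succ_iff_lt_or_eq.mp ht with h1 | h1
  · exact h t h1
  · subst h1; exact h'
lemma E.tail {s : ℕ → Fin 2} {k i j : ℕ} (h : E s (k+1) i j) : E s k (i+1) (j+1) := by
  intro t ht
  have := h (t+1) (by omega)
  rwa [show i + 1 + t = i + (t+1) by ring, show j + 1 + t = j + (t+1) by ring]

lemma ncard_range (s : ℕ → Fin 2) (hs : Sturmian s) (k : ℕ) :
    (Set.range fun i => window s i k).ncard = k + 1 := by
  have h0 : {l : List (Fin 2) | l.length = k ∧ IsFactor s l} = Set.range fun i => window s i k := by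
    ext l
    constructor
    · rintro ⟨h1, i, h2⟩
      exact ⟨i, by rw [h1] at h2; exact h2.symm⟩
    · rintro ⟨i, rfl⟩
      have : (window s i k).length = k := by simp [window]
      exact ⟨this, i, by rw [this]⟩
  rcases Nat.eq_zero_or_pos k with rfl | hk
  · have : (Set.range fun i => window s i 0) = {[]} := by
      ext l; simp [window]
    rw [this]; simp
  · have := hs k hk
    rw [complexity, h0] at this
    exact this

/-- positions pairwise inequivalent -/
def Ineq (s : ℕ → Fin 2) (k : ℕ) (R : Finset ℕ) : Prop :=
  ∀ x ∈ R, ∀ y ∈ R, E s k x y → x = y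

lemma exists_R (s : ℕ → Fin 2) (hs : Sturmian s) (k : ℕ) :
    ∃ R : Finset ℕ, Ineq s k R ∧ R.card = k + 1 := by
  have hn := ncard_range s hs k
  obtain ⟨R, -, hR⟩ := (Set.surjOn_image (fun i => window s i k) Set.univ).exists_bijOn_subset
  have h1 : R.ncard = k + 1 := by
    rw [← hn, ← Set.image_univ, ← hR.image_eq, hR.injOn.ncard_image]
  have hf : R.Finite := Set.finite_of_ncard_ne_zero (by omega)
  refine ⟨hf.toFinset, ?_, ?_⟩
  · intro x hx y hy hxy
    exact hR.injOn (by simpa using hx) (by simpa using hy) ((window_eq s k x y).2 hxy)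
  · rw [← Set.ncard_eq_toFinset_card R hf, h1]

lemma card_le (s : ℕ → Fin 2) (hs : Sturmian s) (k : ℕ) (R : Finset ℕ) (hR : Ineq s k R) :
    R.card ≤ k + 1 := by
  have hn := ncard_range s hs k
  rw [← hn, ← Set.ncard_coe_finset R]
  have : Set.InjOn (fun i => window s i k) (R : Set ℕ) := by
    intro x hx y hy hxy
    exact hR x hx y hy ((window_eq s k x y).1 hxy)
  rw [← this.ncard_image]
  exact Set.ncard_le_ncard (Set.image_subset_range _ _) (Set.finite_of_ncard_ne_zero (by omega))

lemma cover (s : ℕ → Fin 2) (hs : Sturmian s) (k : ℕ) (R : Finset ℕ) (hR : Ineq s k R)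
    (hc : R.card = k + 1) (i : ℕ) : ∃ r ∈ R, E s k i r := by
  by_contra! h
  have hi : i ∉ R := fun hi => h i hi (fun _ _ => rfl)
  have := card_le s hs k (insert i R) (by
    intro x hx y hy hxy
    rw [Finset.mem_insert] at hx hy
    rcases hx with rfl | hx <;> rcases hy with rfl | hy
    · rfl
    · exact absurd hxy (h y hy)
    · exact absurd hxy.symm (h x hx)
    · exact hR x hx y hy hxy)
  rw [Finset.card_insert_of_notMem hi] at this
  omega

lemma aper (s : ℕ → Fin 2) (hs : Sturmian s) (N q : ℕ) (hq : 1 ≤ q)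
    (h : ∀ n ≥ N, s (n + q) = s n) : False := by
  obtain ⟨R, hR, hc⟩ := exists_R s hs (N + q)
  have key : ∀ i, ∃ j < N + q, E s (N+q) i j := by
    intro i
    induction i using Nat.strong_induction_on with
    | _ i ih =>
      by_cases hi : i < N + q
      · exact ⟨i, hi, fun _ _ => rfl⟩
      · obtain ⟨j, hj, hj'⟩ := ih (i - q) (by omega)
        refine ⟨j, hj, fun t ht => ?_⟩
        rw [← hj' t ht, ← h (i - q + t) (by omega)]
        congr 1; omega
  choose f hf hf' using key
  have := Finset.card_le_card_of_injOn (s := R) (t := Finset.range (N+q)) f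
    (fun x _ => by simpa using hf x) (by
      intro x hx y hy hxy
      refine hR x hx y hy ((hf' x).trans ?_)
      rw [hxy]; exact (hf' y).symm)
  rw [Finset.card_range] at this
  omega

lemma exists_special (s : ℕ → Fin 2) (hs : Sturmian s) (k : ℕ) :
    ∃ a b, E s k a b ∧ s (a + k) ≠ s (b + k) := by
  by_contra! h
  obtain ⟨R, hR, hc⟩ := exists_R s hs (k+1)
  have := card_le s hs k R (fun x hx y hy hxy => hR x hx y hy (hxy.succ (h x y hxy)))
  omega

lemma fin2 {a b c : Fin 2} (h1 : a ≠ b) (h2 : a ≠ c) : b = c := by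
  revert a b c; decide

lemma uniq_special (s : ℕ → Fin 2) (hs : Sturmian s) (k : ℕ) {a b c d : ℕ}
    (h1 : E s k a b) (h2 : s (a + k) ≠ s (b + k))
    (h3 : E s k c d) (h4 : s (c + k) ≠ s (d + k)) : E s k a c := by
  by_contra hne
  obtain ⟨R, hR, hc⟩ := exists_R s hs k
  have ext : ∀ a b, E s k a b → s (a + k) ≠ s (b + k) →
      ∃ x, E s k x a ∧ ∀ r ∈ R, ¬ E s (k+1) x r := by
    intro a b h1 h2
    obtain ⟨r, hr, har⟩ := cover s hs k R hR hc a
    by_cases hh : s (a + k) = s (r + k)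
    · refine ⟨b, h1.symm, fun r' hr' h => ?_⟩
      have : r' = r := hR r' hr' r hr (((h.mono (by omega)).symm.trans h1.symm).trans har)
      subst this
      exact h2 (hh.trans (h k (by omega)).symm)
    · refine ⟨a, fun _ _ => rfl, fun r' hr' h => ?_⟩
      have : r' = r := hR r' hr' r hr ((h.mono (by omega)).symm.trans har)
      subst this
      exact hh (h k (by omega))
  obtain ⟨x, hx, hx'⟩ := ext a b h1 h2
  obtain ⟨y, hy, hy'⟩ := ext c d h3 h4
  have hxy : ¬ E s k x y := fun h => hne ((hx.symm.trans h).trans hy)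
  have hxy1 : ¬ E s (k+1) x y := fun h => hxy (h.mono (by omega))
  have hxR : x ∉ R := fun h => hx' x h (fun _ _ => rfl)
  have hyR : y ∉ R := fun h => hy' y h (fun _ _ => rfl)
  have hxney : x ≠ y := by rintro rfl; exact hxy (fun _ _ => rfl)
  have := card_le s hs (k+1) (insert x (insert y R)) (by
    intro u hu v hv huv
    simp only [Finset.mem_insert] at hu hv
    rcases hu with rfl | rfl | hu <;> rcases hv with rfl | rfl | hv
    · rfl
    · exact absurd huv hxy1
    · exact absurd huv (hx' v hv)
    · exact absurd huv.symm hxy1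
    · rfl
    · exact absurd huv (hy' v hv)
    · exact absurd huv.symm (hx' u hu)
    · exact absurd huv.symm (hy' u hu)
    · exact hR u hu v hv (huv.mono (by omega)))
  rw [Finset.card_insert_of_notMem (by simp [hxney, hxR]), Finset.card_insert_of_notMem hyR] at this
  omega

/-- core contradiction -/
lemma core (s : ℕ → Fin 2) (hs : Sturmian s) (m a b i : ℕ)
    (h1 : E s (m+1) a b) (h2 : s (a + (m+1)) ≠ s (b + (m+1)))
    (hi : s i ≠ s a) (hi' : s (i + m + 1) = s i) (hw : E s m (a+1) (i+1))
    (hpal : ∀ t < m, s (i + 1 + t) = s (i + 1 + (m - 1 - t))) : False := by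
  have hno : ∀ p, i ≤ p → p ≤ i + m + 1 → ¬ E s (m+1) p a := by
    intro p hp1 hp2 hE
    have h0 := hE 0 (by omega)
    simp only [add_zero] at h0
    rcases Nat.eq_or_lt_of_le hp1 with rfl | hp1
    · exact hi h0
    rcases Nat.eq_or_lt_of_le hp2 with rfl | hp2
    · exact hi (hi' ▸ h0)
    obtain ⟨j, rfl⟩ : ∃ j, p = i + 1 + j := ⟨p - (i+1), by omega⟩
    have e1 := hE (m - j) (by omega)
    have e2 := hw (m - 1 - j) (by omega)
    have e3 := hpal j (by omega)
    rw [show i + 1 + j + (m - j) = i + m + 1 by omega, hi',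
      show a + (m - j) = a + 1 + (m - 1 - j) by omega, e2, ← e3, h0] at e1
    exact hi e1
  have hns : ∀ p, i ≤ p → p ≤ i + m + 1 → ∀ p', E s (m+1) p p' →
      s (p + (m+1)) = s (p' + (m+1)) := by
    intro p hp1 hp2 p' hE
    by_contra hne
    exact hno p hp1 hp2 (uniq_special s hs (m+1) hE hne h1 h2)
  obtain ⟨x, y, hx, hxy, hy, hE⟩ : ∃ x y, i ≤ x ∧ x < y ∧ y ≤ i + m + 1 ∧ E s (m+1) x y := by
    by_contra! hcon
    have ha : a ∉ Finset.Icc i (i + m + 1) := by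
      intro ha
      rw [Finset.mem_Icc] at ha
      exact hno a ha.1 ha.2 (fun _ _ => rfl)
    have := card_le s hs (m+1) (insert a (Finset.Icc i (i+m+1))) (by
      intro u hu v hv huv
      simp only [Finset.mem_insert, Finset.mem_Icc] at hu hv
      rcases hu with rfl | hu <;> rcases hv with rfl | hv
      · rfl
      · exact absurd huv.symm (hno v hv.1 hv.2)
      · exact absurd huv (hno u hu.1 hu.2)
      · rcases lt_trichotomy u v with h | h | h
        · exact absurd huv (hcon u v hu.1 h hv.2)
        · exact h
        · exact absurd huv.symm (hcon v u hv.1 h hu.2))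
    rw [Finset.card_insert_of_notMem ha, Nat.card_Icc] at this
    omega
  have key : ∀ M, ∃ r, x ≤ r ∧ r < y ∧ E s (m+1) r (x + M) ∧ E s (m+1) r (y + M) := by
    intro M
    induction M with
    | zero => exact ⟨x, le_rfl, hxy, fun _ _ => rfl, hE⟩
    | succ M ih =>
      obtain ⟨r, hr1, hr2, e1, e2⟩ := ih
      have f1 := (e1.succ (hns r (by omega) (by omega) _ e1)).tail
      have f2 := (e2.succ (hns r (by omega) (by omega) _ e2)).tail
      by_cases hr : r + 1 < y
      · exact ⟨r+1, by omega, hr, f1, f2⟩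
      · have : r + 1 = y := by omega
        rw [this] at f1 f2
        exact ⟨x, le_rfl, hxy, hE.trans f1, hE.trans f2⟩
  refine aper s hs x (y - x) (by omega) (fun n hn => ?_)
  obtain ⟨r, -, -, e1, e2⟩ := key (n - x)
  have g1 := e1 0 (by omega)
  have g2 := e2 0 (by omega)
  simp only [add_zero] at g1 g2
  rw [show n + (y - x) = y + (n - x) by omega, ← g2, g1]
  congr 1; omega

/-- weights -/
def W (s : ℕ → Fin 2) (i n : ℕ) : ℤ := ∑ t ∈ Finset.range n, ((s (i + t) : ℕ) : ℤ)

lemma W_zero (s : ℕ → Fin 2) (i : ℕ) : W s i 0 = 0 := by simp [W]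
lemma W_succ (s : ℕ → Fin 2) (i n : ℕ) : W s i (n+1) = W s i n + ((s (i + n) : ℕ) : ℤ) := by
  simp [W, Finset.sum_range_succ]
lemma W_add (s : ℕ → Fin 2) (i n k : ℕ) : W s i (n+k) = W s i n + W s (i+n) k := by
  simp [W, Finset.sum_range_add, add_assoc]
lemma W_one (s : ℕ → Fin 2) (i : ℕ) : W s i 1 = ((s i : ℕ) : ℤ) := by simp [W]

lemma fb (x : Fin 2) : 0 ≤ ((x : ℕ) : ℤ) ∧ ((x : ℕ) : ℤ) ≤ 1 := by omega
lemma finj {x y : Fin 2} (h : ((x : ℕ) : ℤ) = ((y : ℕ) : ℤ)) : x = y := by omega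

lemma balanced (s : ℕ → Fin 2) (hs : Sturmian s) (n i j : ℕ) : W s i n ≤ W s j n + 1 := by
  induction n using Nat.strong_induction_on generalizing i j with
  | _ n ih =>
  by_contra! hlt
  have hn : 2 ≤ n := by
    by_contra! h
    interval_cases n
    · simp [W_zero] at hlt
    · rw [W_one, W_one] at hlt
      have := fb (s i); have := fb (s j); omega
  obtain ⟨m, rfl⟩ : ∃ m, n = m + 2 := ⟨n - 2, by omega⟩
  have hsplit : ∀ t t', t + t' = m + 2 → ∀ i, W s i (m+2) = W s i t + W s (i+t) t' := by
    intro t t' h i; rw [← W_add, h]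
  -- middle differences
  have hD : ∀ t, 1 ≤ t → t ≤ m + 1 → W s i t = W s j t + 1 := by
    intro t h1 h2
    have a1 := ih t (by omega) i j
    have a2 := ih (m + 2 - t) (by omega) (i+t) (j+t)
    have a3 := hsplit t (m+2-t) (by omega) i
    have a4 := hsplit t (m+2-t) (by omega) j
    omega
  have hi0 : ((s i : ℕ) : ℤ) = 1 ∧ ((s j : ℕ) : ℤ) = 0 := by
    have := hD 1 le_rfl (by omega)
    rw [W_one, W_one] at this
    have := fb (s i); have := fb (s j); omega
  have hi1 : ((s (i + (m+1)) : ℕ) : ℤ) = 1 ∧ ((s (j + (m+1)) : ℕ) : ℤ) = 0 := by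
    have := hD (m+1) (by omega) le_rfl
    rw [show m + 2 = (m+1) + 1 by ring, W_succ s i (m+1), W_succ s j (m+1)] at hlt
    have := fb (s (i + (m+1))); have := fb (s (j + (m+1))); omega
  have hmid : E s m (i+1) (j+1) := by
    intro t ht
    have a1 := hD (t+1) (by omega) (by omega)
    have a2 := hD (t+1+1) (by omega) (by omega)
    rw [W_succ s i (t+1), W_succ s j (t+1)] at a2
    rw [show i + 1 + t = i + (t+1) by ring, show j + 1 + t = j + (t+1) by ring]
    apply finj; omega
  -- palindrome
  have hWmid : ∀ a t, a + t ≤ m → W s (i+1+a) t = W s (j+1+a) t := by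
    intro a t h
    unfold W
    refine Finset.sum_congr rfl fun u hu => ?_
    rw [Finset.mem_range] at hu
    have := hmid (a+u) (by omega)
    rw [add_assoc (i+1), add_assoc (j+1), this]
  have hpq : ∀ t ≤ m, W s (i+1) t = W s (i + 1 + (m - t)) t := by
    intro t ht
    have a1 := ih (1+t) (by omega) i (j + 1 + (m - t))
    have a2 := ih (t+1) (by omega) (i + 1 + (m - t)) j
    have a3 := hWmid (m-t) t (by omega)
    have a4 := hWmid 0 t (by omega)
    simp only [add_zero] at a4
    rw [W_succ, add_comm t 1, W_add s j 1 t, W_one, 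
      show i + 1 + (m - t) + t = i + (m+1) by omega] at a2
    rw [W_add, W_one, add_comm 1 t, W_succ, show j + 1 + (m - t) + t = j + (m+1) by omega] at a1
    omega
  have hpal : ∀ t < m, s (i + 1 + t) = s (i + 1 + (m - 1 - t)) := by
    intro t ht
    have a1 := hpq t (by omega)
    have a2 := hpq (t+1) (by omega)
    rw [W_succ, add_comm t 1, W_add s _ 1 t, W_one,
      show i + 1 + (m - (1+t)) = i + 1 + (m - 1 - t) by omega,
      show i + 1 + (m - 1 - t) + 1 = i + 1 + (m - t) by omega] at a2
    apply finj; omega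
  have hpalj : ∀ t < m, s (j + 1 + t) = s (j + 1 + (m - 1 - t)) := by
    intro t ht
    rw [← hmid t ht, ← hmid (m-1-t) (by omega), hpal t ht]
  obtain ⟨a, b, hab, hab'⟩ := exists_special s hs (m+1)
  have hspec : s (i + 1 + m) ≠ s (j + 1 + m) := by
    intro h
    rw [show i + 1 + m = i + (m+1) by ring, show j + 1 + m = j + (m+1) by ring] at h
    rw [h] at hi1; omega
  have haw : E s m (a+1) (i+1) := uniq_special s hs m hab.tail
    (by rwa [show a + 1 + m = a + (m+1) by ring, show b + 1 + m = b + (m+1) by ring]) hmid hspec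
  by_cases hc : s i = s a
  · refine core s hs m a b j hab hab' ?_ ?_ (haw.trans hmid) hpalj
    · rw [← hc]; intro h; rw [h] at hi0; omega
    · apply finj; rw [add_assoc]; omega
  · refine core s hs m a b i hab hab' hc ?_ haw hpal
    apply finj; rw [add_assoc]; omega

lemma iter (s : ℕ → Fin 2) (k n : ℕ) : (shiftMap^[k] s) n = s (k + n) := by
  induction k generalizing n with
  | zero => simp
  | succ k ih =>
    rw [Function.iterate_succ_apply', shiftMap, ih]
    congr 1; ring

lemma W_max (s : ℕ → Fin 2) (hs : Sturmian s) (h : ∀ k, SeqLe (shiftMap^[k] s) s) (k n : ℕ) :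
    W s k n ≤ W s 0 n := by
  rcases h k with h | ⟨i, h1, h2⟩
  · simp only [iter] at h
    apply le_of_eq
    unfold W
    exact Finset.sum_congr rfl fun t _ => by rw [h t, zero_add]
  · simp only [iter] at h1 h2
    have hle : ∀ n ≤ i, W s k n = W s 0 n := by
      intro n hn
      unfold W
      refine Finset.sum_congr rfl fun t ht => ?_
      rw [Finset.mem_range] at ht
      rw [h1 t (by omega), zero_add]
    by_cases hn : n ≤ i
    · exact (hle n hn).le
    · obtain ⟨t, rfl⟩ : ∃ t, n = i + 1 + t := ⟨n - (i+1), by omega⟩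
      have a1 := balanced s hs t (k + (i+1)) (0 + (i+1))
      have a2 := hle i le_rfl
      rw [W_add, W_succ, W_add s 0, W_succ s 0, zero_add i]
      have : ((s (k+i) : ℕ) : ℤ) + 1 ≤ ((s i : ℕ) : ℤ) := by
        have : ((s (k+i) : ℕ)) < ((s i : ℕ)) := h2
        omega
      rw [zero_add] at a1 ⊢
      omega

lemma lex_of_W (s : ℕ → Fin 2) (k : ℕ) (h : ∀ n, W s k n ≤ W s 0 n) :
    SeqLe (shiftMap^[k] s) s := by
  by_cases hall : ∀ n, s (k + n) = s n
  · left; intro n; rw [iter, hall]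
  · right
    push Not at hall
    classical
    refine ⟨Nat.find hall, fun j hj => ?_, ?_⟩
    · rw [iter]; have := Nat.find_min hall hj; simpa using this
    · rw [iter]
      have h1 := Nat.find_spec hall
      have h2 : ∀ j < Nat.find hall, s (k + j) = s j := fun j hj => by
        have := Nat.find_min hall hj; simpa using this
      generalize Nat.find hall = i at *
      have h3 := h (i+1)
      rw [W_succ, W_succ] at h3
      have h4 : W s k i = W s 0 i := by
        unfold W
        refine Finset.sum_congr rfl fun t ht => ?_
        rw [Finset.mem_range] at ht
        rw [h2 t ht, zero_add]
      rw [zero_add] at h3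
      have : (s (k+i) : ℕ) ≠ (s i : ℕ) := fun h => h1 (Fin.ext h)
      show (s (k+i) : ℕ) < (s i : ℕ)
      omega

lemma eventually (g : ℕ → ℤ) (q : ℕ) (hq : 1 ≤ q) (h0 : ∀ n, 0 ≤ g n) (h1 : ∀ n, g n ≤ q)
    (h2 : ∀ n, g (n + q) = g n ∨ g n + q ≤ g (n+q)) : ∃ N, ∀ n ≥ N, g (n+q) = g n := by
  have hmono : ∀ m n, g n ≤ g (n + m * q) := by
    intro m
    induction m with
    | zero => intro n; simp
    | succ m ih =>
      intro n
      have := ih n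
      have h := h2 (n + m * q)
      rw [show n + (m+1) * q = n + m * q + q by ring]
      omega
  have hfin : {n | g (n+q) ≠ g n}.Finite := by
    refine Set.Finite.of_injOn (f := fun n => n % q) (t := (Finset.range q : Set ℕ)) ?_ ?_
      (Finset.finite_toSet _)
    · intro n _
      simpa using Nat.mod_lt n (by omega)
    · have main : ∀ x y, g (x+q) ≠ g x → g (y+q) ≠ g y → x % q = y % q → x < y → False := by
        intro x y hx hy hxy hlt
        have d : q ∣ y - x := (Nat.modEq_iff_dvd' hlt.le).1 hxy
        obtain ⟨m, hm⟩ := d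
        have hm0 : m ≠ 0 := by rintro rfl; omega
        obtain ⟨m, rfl⟩ := Nat.exists_eq_succ_of_ne_zero hm0
        have e : y = x + q + m * q := by
          rw [Nat.succ_eq_add_one] at hm
          have : q * (m+1) = q + m * q := by ring
          omega
        have a1 := hmono m (x+q)
        rw [← e] at a1
        have := h2 x; have := h2 y; have := h0 x; have := h1 (y+q)
        omega
      intro x hx y hy hxy
      rcases lt_trichotomy x y with h | h | h
      · exact (main x y hx hy hxy h).elim
      · exact h
      · exact (main y x hy hx hxy.symm h).elim
  obtain ⟨N, hN⟩ := hfin.bddAbove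
  refine ⟨N+1, fun n hn => ?_⟩
  by_contra hne
  have := hN hne
  omega

lemma slope (s : ℕ → Fin 2) (hs : Sturmian s) (h : ∀ k, SeqLe (shiftMap^[k] s) s) :
    ∃ α : ℝ, Irrational α ∧ ∀ n : ℕ, (n : ℝ) * α ≤ W s 0 n ∧ (W s 0 n : ℝ) ≤ n * α + 1 := by
  have hub := W_max s hs h
  have hlb : ∀ k n, W s 0 n ≤ W s k n + 1 := fun k n => balanced s hs n 0 k
  have hup : ∀ n m, W s 0 (n * m) ≤ n * W s 0 m := by
    intro n m
    induction n with
    | zero => simp [W_zero]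
    | succ n ih =>
      rw [Nat.succ_mul, W_add]
      have := hub (0 + n * m) m
      push_cast; linarith
  have hlo : ∀ n m : ℕ, (n:ℤ) * (W s 0 m - 1) ≤ W s 0 (n * m) := by
    intro n m
    induction n with
    | zero => simp [W_zero]
    | succ n ih =>
      rw [Nat.succ_mul, W_add]
      have := hlb (0 + n * m) m
      push_cast; linarith
  have hcmp : ∀ n m : ℕ, ((W s 0 (n+1) : ℝ) - 1) / (n+1) ≤ (W s 0 (m+1) : ℝ) / (m+1) := by
    intro n m
    rw [div_le_div_iff₀ (by positivity) (by positivity)]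
    have a1 := hup (n+1) (m+1)
    have a2 := hlo (m+1) (n+1)
    rw [mul_comm (m+1) (n+1)] at a2
    have a3 := a2.trans a1
    have : (((m+1:ℕ):ℤ) : ℝ) * ((W s 0 (n+1) : ℝ) - 1) ≤ (((n+1:ℕ):ℤ):ℝ) * (W s 0 (m+1) : ℝ) := by
      exact_mod_cast a3
    push_cast at this
    linarith
  have hbdd : BddBelow (Set.range fun m : ℕ => (W s 0 (m+1) : ℝ) / (m+1)) :=
    ⟨_, by rintro _ ⟨m, rfl⟩; exact hcmp 0 m⟩
  obtain ⟨α, hα⟩ : ∃ α : ℝ, α = ⨅ m : ℕ, (W s 0 (m+1) : ℝ) / (m+1) := ⟨_, rfl⟩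
  have hb : ∀ n : ℕ, (n : ℝ) * α ≤ W s 0 n ∧ (W s 0 n : ℝ) ≤ n * α + 1 := by
    intro n
    cases n with
    | zero => simp [W_zero]
    | succ n =>
      have a1 : α ≤ _ := hα ▸ ciInf_le hbdd n
      have a2 : _ ≤ α := hα ▸ le_ciInf (hcmp n)
      rw [le_div_iff₀ (by positivity)] at a1
      rw [div_le_iff₀ (by positivity)] at a2
      push_cast
      constructor <;> linarith
  refine ⟨α, ?_, hb⟩
  rintro ⟨r, hr⟩
  obtain ⟨p, q, hq, rfl⟩ : ∃ (p : ℤ) (q : ℕ), 1 ≤ q ∧ α = p / q :=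
    ⟨r.num, r.den, r.pos, by rw [← hr]; exact Rat.cast_def r⟩
  have hqr : (0:ℝ) < q := by exact_mod_cast hq
  have hg : ∀ n : ℕ, 0 ≤ q * W s 0 n - p * n ∧ q * W s 0 n - p * n ≤ q := by
    intro n
    obtain ⟨a1, a2⟩ := hb n
    rw [mul_div_assoc', div_le_iff₀ hqr] at a1
    rw [← sub_le_iff_le_add, mul_div_assoc', le_div_iff₀ hqr] at a2
    have a1' : (n:ℤ) * p ≤ W s 0 n * q := by exact_mod_cast a1
    have a2' : (W s 0 n - 1) * q ≤ (n:ℤ) * p := by exact_mod_cast a2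
    constructor <;> linarith
  have hq0 : (0:ℤ) < q := by exact_mod_cast hq
  have hSq : W s 0 q = p ∨ W s 0 q = p + 1 := by
    obtain ⟨a1, a2⟩ := hg q
    have : p ≤ W s 0 q := by
      by_contra! hh; nlinarith
    have : W s 0 q ≤ p + 1 := by
      by_contra! hh; nlinarith
    omega
  have hstep : ∀ n : ℕ, (q * W s 0 (n+q) - p * (n+q:ℕ)) = (q * W s 0 n - p * n) + q * (W s n q - p) := by
    intro n
    rw [W_add, zero_add]; push_cast; ring
  have hev : ∃ N, ∀ n ≥ N, W s n q = p := by
    rcases hSq with h1 | h1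
    · obtain ⟨N, hN⟩ := eventually (fun n => q - (q * W s 0 n - p * n)) q hq
        (fun n => by have := hg n; linarith) (fun n => by have := hg n; linarith) (by
          intro n
          simp only [hstep]
          have a1 := hub n q
          have a2 := hlb n q
          have : W s n q = p ∨ W s n q = p - 1 := by omega
          rcases this with e | e <;> rw [e]
          · left; ring
          · right; apply le_of_eq; ring)
      refine ⟨N, fun n hn => ?_⟩
      have := hN n hn
      simp only [hstep] at this
      have h0 : (q:ℤ) * (W s n q - p) = 0 := by linarith
      rcases mul_eq_zero.1 h0 with h0 | h0 <;> omega
    · obtain ⟨N, hN⟩ := eventually (fun n => (q * W s 0 n - p * n)) q hq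
        (fun n => (hg n).1) (fun n => (hg n).2) (by
          intro n
          simp only [hstep]
          have a1 := hub n q
          have a2 := hlb n q
          have : W s n q = p ∨ W s n q = p + 1 := by omega
          rcases this with e | e <;> rw [e]
          · left; ring
          · right; apply le_of_eq; ring)
      refine ⟨N, fun n hn => ?_⟩
      have := hN n hn
      simp only [hstep] at this
      have h0 : (q:ℤ) * (W s n q - p) = 0 := by linarith
      rcases mul_eq_zero.1 h0 with h0 | h0 <;> omega
  obtain ⟨N, hN⟩ := hev
  refine aper s hs N q hq (fun n hn => ?_)
  have a1 := hN n hn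
  have a2 := hN (n+1) (by omega)
  have a3 := W_succ s n q
  rw [add_comm q 1, W_add, W_one] at a3
  apply finj; omega

lemma fin2_cases (x : Fin 2) : x = 0 ∨ x = 1 := by omega

lemma forward (s : ℕ → Fin 2) (hs : Sturmian s)
    (h : ∀ k : ℕ, SeqLe (flipSeq s) (shiftMap^[k] s) ∧ SeqLe (shiftMap^[k] s) s) :
    ∃ α : ℝ, α ∈ Set.Ioo (0 : ℝ) 1 ∧ Irrational α ∧
      ∃ c : ℕ → Fin 2, IsCharSturmian α c ∧ c 0 = 1 ∧ s = pre 1 c := by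
  have hmax := W_max s hs (fun k => (h k).2)
  have hs0 : s 0 = 1 := by
    rcases fin2_cases (s 0) with h0 | h0
    · exfalso
      have hz : ∀ k, s k = 0 := by
        intro k
        have := hmax k 1
        rw [W_one, W_one, h0] at this
        have := fb (s k)
        apply finj; simp at *; omega
      exact aper s hs 0 1 le_rfl (fun n _ => by rw [hz, hz])
    · exact h0
  have hs1 : s 1 = 1 := by
    rcases fin2_cases (s 1) with h1 | h1
    · exfalso
      have no11 : ∀ k, ¬ (s k = 1 ∧ s (k+1) = 1) := by
        rintro k ⟨e1, e2⟩
        have := hmax k (1+1)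
        rw [W_succ s k 1, W_succ s 0 1, W_one, W_one, hs0, zero_add, h1, e1, e2] at this
        simp at this
      have no00 : ∀ k, ¬ (s k = 0 ∧ s (k+1) = 0) := by
        rintro k ⟨e1, e2⟩
        have f0 : flipSeq s 0 = 0 := by simp [flipSeq, hs0]
        have f1 : flipSeq s 1 = 1 := by simp [flipSeq, h1]
        rcases (h k).1 with hh | ⟨i, hh1, hh2⟩
        · have := hh 1
          rw [iter, f1, e2] at this
          exact absurd this (by decide)
        · rw [iter] at hh2
          rcases i with _ | _ | i
          · rw [f0, add_zero, e1] at hh2; exact absurd hh2 (by decide)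
          · rw [zero_add, f1, e2] at hh2; exact absurd hh2 (by decide)
          · have := hh1 1 (by omega)
            rw [iter, f1, e2] at this
            exact absurd this (by decide)
      refine aper s hs 0 2 (by omega) (fun n _ => ?_)
      have a1 := no11 n; have a2 := no11 (n+1); have a3 := no00 n; have a4 := no00 (n+1)
      rw [show n + 1 + 1 = n + 2 by ring] at a2 a4
      rcases fin2_cases (s n) with b1 | b1 <;> rcases fin2_cases (s (n+1)) with b2 | b2 <;>
        rcases fin2_cases (s (n+2)) with b3 | b3 <;> simp_all
    · exact h1
  obtain ⟨α, hirr, hb⟩ := slope s hs (fun k => (h k).2)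
  have hfl : ∀ n : ℕ, ⌊((n:ℝ) + 1) * α⌋ = W s 0 (n+1) - 1 := by
    intro n
    obtain ⟨a1, a2⟩ := hb (n+1)
    push_cast at a1 a2
    have hir : Irrational (((n+1:ℕ) : ℝ) * α) := hirr.natCast_mul (by omega)
    have hne : ((n:ℝ) + 1) * α ≠ W s 0 (n+1) := by
      have := hir.ne_int (W s 0 (n+1)); push_cast at this; exact this
    rw [Int.floor_eq_iff]
    push_cast
    refine ⟨by linarith, ?_⟩
    have := lt_of_le_of_ne a1 hne
    linarith
  have hα : α ∈ Set.Ioo (0:ℝ) 1 := by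
    have := hb 1
    rw [W_one, hs0] at this
    simp at this
    have h0 := hirr.ne_nat 0
    have h1 := hirr.ne_nat 1
    push_cast at h0 h1
    exact ⟨lt_of_le_of_ne this.2 (Ne.symm h0), lt_of_le_of_ne this.1 h1⟩
  refine ⟨α, hα, hirr, shiftMap s, ?_, hs1, ?_⟩
  · intro n
    have a1 := hfl n
    have a2 := hfl (n+1)
    rw [W_succ] at a2
    push_cast at a2
    rw [add_assoc, one_add_one_eq_two] at a2
    rw [a1, a2, zero_add, shiftMap]
    ring
  · funext n
    cases n with
    | zero => exact hs0
    | succ n => rfl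

lemma backward (s : ℕ → Fin 2) (α : ℝ) (hα : α ∈ Set.Ioo (0:ℝ) 1)
    (c : ℕ → Fin 2) (hc : IsCharSturmian α c) (hc0 : c 0 = 1) (hsc : s = pre 1 c) (k : ℕ) :
    SeqLe (flipSeq s) (shiftMap^[k] s) ∧ SeqLe (shiftMap^[k] s) s := by
  have hs0 : s 0 = 1 := by rw [hsc]; rfl
  have hss : ∀ n, s (n+1) = c n := by intro n; rw [hsc]; rfl
  have hfα : ⌊α⌋ = 0 := by rw [Int.floor_eq_iff]; push_cast; exact ⟨hα.1.le, by linarith [hα.2]⟩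
  have hS : ∀ n : ℕ, W s 0 (n+1) = ⌊((n:ℝ)+1) * α⌋ + 1 := by
    intro n
    induction n with
    | zero => rw [zero_add, W_one, hs0]; simp [hfα]
    | succ n ih =>
      rw [W_succ, ih, zero_add, hss, hc n]
      push_cast
      rw [show (n:ℝ) + 1 + 1 = n + 2 by ring]
      ring
  refine ⟨?_, lex_of_W s k ?_⟩
  · have f0 : flipSeq s 0 = 0 := by simp [flipSeq, hs0]
    have f1 : flipSeq s 1 = 0 := by simp [flipSeq, hss, hc0]
    right
    rcases fin2_cases (s k) with hk | hk
    · refine ⟨1, ?_, ?_⟩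
      · intro j hj
        obtain rfl : j = 0 := by omega
        rw [iter, f0, add_zero, hk]
      · rw [iter, f1]
        rcases fin2_cases (s (k+1)) with hk1 | hk1
        · exfalso
          obtain ⟨n, rfl⟩ : ∃ n, k = n + 1 := by
            cases k with
            | zero => rw [hs0] at hk; exact absurd hk (by decide)
            | succ n => exact ⟨n, rfl⟩
          have b0 := hc 0
          have b1 := hc n
          have b2 := hc (n+1)
          rw [hss] at hk hk1
          rw [hc0] at b0
          rw [hk] at b1
          rw [hk1] at b2
          push_cast at b0 b1 b2
          simp only [zero_add, one_mul, hfα] at b0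
          rw [show (n:ℝ) + 1 + 1 = n + 2 by ring] at b2
          have e : ⌊(2:ℝ) * α⌋ = 1 := by simpa using b0.symm
          have e2 : (1:ℝ) ≤ 2 * α := by
            have := Int.floor_le ((2:ℝ) * α); rw [e] at this; simpa using this
          have e3 : ⌊((n:ℝ) + 1) * α⌋ + 1 ≤ ⌊((n:ℝ) + 1 + 2) * α⌋ := by
            rw [Int.le_floor]; push_cast
            have := Int.floor_le (((n:ℝ) + 1) * α)
            linarith
          simp at b1 b2
          omega
        · rw [hk1]; decide
    · exact ⟨0, by simp, by rw [iter, f0, add_zero, hk]; decide⟩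
  · intro n
    cases k with
    | zero => exact le_rfl
    | succ k =>
    cases n with
    | zero => simp [W_zero]
    | succ n =>
      have a1 := W_add s 0 (k+1) (n+1)
      rw [show k + 1 + (n+1) = (k + n + 1) + 1 by ring, hS, hS, zero_add] at a1
      rw [hS]
      push_cast at a1
      have e3 : ⌊((k:ℝ) + n + 1 + 1) * α⌋ ≤ ⌊((k:ℝ) + 1) * α⌋ + ⌊((n:ℝ) + 1) * α⌋ + 1 := by
        have := Int.lt_floor_add_one (((k:ℝ) + 1) * α)
        have := Int.lt_floor_add_one (((n:ℝ) + 1) * α)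
        rw [← Int.lt_add_one_iff, Int.floor_lt]
        push_cast
        linarith
      omega

end St

/-- A Sturmian binary sequence `s` satisfies `ū ≤ Tᵏ(s) ≤ s` for all `k ≥ 0`
(i.e. `s ∈ Γ`) iff `s = 1·c_α` for some characteristic Sturmian sequence `c_α`
(of irrational slope `α ∈ (0,1)`) beginning with the letter `1`. -/
theorem stmt19 (s : ℕ → Fin 2) (hs : Sturmian s) :
    (∀ k : ℕ, SeqLe (flipSeq s) (shiftMap^[k] s) ∧ SeqLe (shiftMap^[k] s) s) ↔
    (∃ α : ℝ, α ∈ Set.Ioo (0 : ℝ) 1 ∧ Irrational α ∧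
      ∃ c : ℕ → Fin 2, IsCharSturmian α c ∧ c 0 = 1 ∧ s = pre 1 c) := by
  constructor
  · exact St.forward s hs
  · rintro ⟨α, hα, -, c, hc, hc0, hsc⟩ k
    exact St.backward s α hα c hc hc0 hsc k
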